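/- arXiv:math/0004080 — 2 statements merged into one kernel-verified Lean document; each statement's English description precedes it below -/
import Mathlib

section
/- Let G be a finite simple graph on a finite vertex set V with n = |V| and let A, B be distinct vertices. Define R̂(H)(X) = Σ_{J ⊆ V} (−1)^{n−|J|} X^{rank(H_J)} ∈ ℤ[X] for any graph H on V, where H_J is the induced subgraph on J and rank is the rank over ℤ/2ℤ of the adjacency matrix. Then R̂ satisfies the 4-term relation: R̂(G) − R̂(G'_{AB}) − R̂(G̃_{AB}) + R̂(G̃'_{AB}) = 0. -/
open Matrix Polynomial

/-- The graph obtained from `G` by toggling (adding if absent, deleting if present)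
the edge `{A, B}`. -/
def toggleEdge {V : Type*} (G : SimpleGraph V) (A B : V) : SimpleGraph V :=
  SimpleGraph.fromEdgeSet (symmDiff G.edgeSet {s(A, B)})

/-- The graph `G̃_{AB}`: toggle the edge `{A, C}` for every vertex `C ∉ {A, B}`
that is adjacent to `B` in `G`; all other adjacencies are unchanged. -/
def gTilde {V : Type*} (G : SimpleGraph V) (A B : V) : SimpleGraph V :=
  SimpleGraph.fromEdgeSet (symmDiff G.edgeSet
    {e | ∃ C, C ≠ A ∧ C ≠ B ∧ G.Adj B C ∧ e = s(A, C)})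

open Classical in
/-- The adjacency matrix over `ℤ/2ℤ` of the induced subgraph of `G` on the
vertex subset `J`. -/
noncomputable def inducedAdj {V : Type*} (G : SimpleGraph V) (J : Finset V) :
    Matrix {x // x ∈ J} {x // x ∈ J} (ZMod 2) :=
  Matrix.of fun i j => if G.Adj i.1 j.1 then 1 else 0

/-- The deframed rank polynomial
`R̂(G)(X) = Σ_{J ⊆ V} (−1)^{n−|J|} X^{rank(G_J)} ∈ ℤ[X]`. -/
noncomputable def Rhat {V : Type*} [Fintype V] [DecidableEq V] (G : SimpleGraph V) :
    Polynomial ℤ :=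
  ∑ J : Finset V, (-1 : Polynomial ℤ) ^ (Fintype.card V - J.card) *
    Polynomial.X ^ (inducedAdj G J).rank

theorem toggleEdge_adj {V : Type*} (G : SimpleGraph V) {A B : V} (hAB : A ≠ B) (u v : V) :
    (toggleEdge G A B).Adj u v ↔ Xor (G.Adj u v) (u = A ∧ v = B ∨ u = B ∧ v = A) := by
  have := G.ne_of_adj (a := u) (b := v)
  simp only [toggleEdge, SimpleGraph.fromEdgeSet_adj, Set.mem_symmDiff, SimpleGraph.mem_edgeSet,
    Set.mem_singleton_iff, Sym2.eq_iff, Xor]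
  grind

theorem gTilde_adj {V : Type*} (G : SimpleGraph V) {A B : V} (u v : V) :
    (gTilde G A B).Adj u v ↔ Xor (G.Adj u v)
      (u = A ∧ v ≠ A ∧ v ≠ B ∧ G.Adj B v ∨ v = A ∧ u ≠ A ∧ u ≠ B ∧ G.Adj B u) := by
  have := G.ne_of_adj (a := u) (b := v)
  have h : (∃ C, C ≠ A ∧ C ≠ B ∧ G.Adj B C ∧ s(u, v) = s(A, C)) ↔
      (u = A ∧ v ≠ A ∧ v ≠ B ∧ G.Adj B v ∨ v = A ∧ u ≠ A ∧ u ≠ B ∧ G.Adj B u) := by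
    simp only [Sym2.eq_iff]
    grind
  simp only [gTilde, SimpleGraph.fromEdgeSet_adj, Set.mem_symmDiff, SimpleGraph.mem_edgeSet,
    Set.mem_ofPred_eq, h, Xor]
  grind

theorem toggleEdge_gTilde {V : Type*} (G : SimpleGraph V) {A B : V} (hAB : A ≠ B) :
    toggleEdge (gTilde G A B) A B = gTilde (toggleEdge G A B) A B := by
  ext u v
  simp only [toggleEdge_adj _ hAB, gTilde_adj, Xor]
  grind

theorem inducedAdj_toggleEdge {V : Type*} (G : SimpleGraph V) {A B : V} (hAB : A ≠ B)
    {J : Finset V} (hJ : ¬ (A ∈ J ∧ B ∈ J)) :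
    inducedAdj (toggleEdge G A B) J = inducedAdj G J := by
  ext ⟨u, hu⟩ ⟨v, hv⟩
  have h : (toggleEdge G A B).Adj u v ↔ G.Adj u v := by
    rw [toggleEdge_adj _ hAB, Xor]
    grind
  classical exact if_congr h rfl rfl

/-- Adding the row and column of `B` to those of `A` turns the adjacency matrix of `G` into
that of `gTilde G A B`. -/
theorem inducedAdj_gTilde {V : Type*} [DecidableEq V] (G : SimpleGraph V) {A B : V}
    (hAB : A ≠ B) {J : Finset V} (hA : A ∈ J) (hB : B ∈ J) :
    inducedAdj (gTilde G A B) J =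
      transvection ⟨A, hA⟩ ⟨B, hB⟩ 1 * inducedAdj G J * transvection ⟨B, hB⟩ ⟨A, hA⟩ 1 := by
  ext ⟨u, hu⟩ ⟨v, hv⟩
  have key : inducedAdj (gTilde G A B) J ⟨u, hu⟩ ⟨v, hv⟩ =
      inducedAdj G J ⟨u, hu⟩ ⟨v, hv⟩ + (if u = A then inducedAdj G J ⟨B, hB⟩ ⟨v, hv⟩ else 0) +
      (if v = A then inducedAdj G J ⟨u, hu⟩ ⟨B, hB⟩ +
        (if u = A then inducedAdj G J ⟨B, hB⟩ ⟨B, hB⟩ else 0) else 0) := by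
    have h := gTilde_adj G (A := A) (B := B) u v
    have hsymm := G.adj_comm u B
    have hBB := G.irrefl (v := B)
    have h2 : (1 : ZMod 2) + 1 = 0 := rfl
    simp only [inducedAdj, Matrix.of_apply, hsymm]
    rw [Xor] at h
    by_cases hu : u = A <;> by_cases hv : v = A <;> by_cases h1 : G.Adj u v <;>
      by_cases h3 : G.Adj B u <;> by_cases h4 : G.Adj B v <;> grind
  rw [key]
  by_cases hu : u = A <;> by_cases hv : v = A
  · subst hu hv
    simp [add_assoc]
  · subst hu
    simp [hv, mul_transvection_apply_of_ne]
  · subst hv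
    simp [hu, transvection_mul_apply_of_ne]
  · simp [hu, hv, mul_transvection_apply_of_ne, transvection_mul_apply_of_ne]

theorem rank_inducedAdj_gTilde {V : Type*} [DecidableEq V] (G : SimpleGraph V) {A B : V}
    (hAB : A ≠ B) {J : Finset V} (hA : A ∈ J) (hB : B ∈ J) :
    (inducedAdj (gTilde G A B) J).rank = (inducedAdj G J).rank := by
  rw [inducedAdj_gTilde G hAB hA hB, rank_mul_eq_left_of_isUnit_det,
    rank_mul_eq_right_of_isUnit_det]
  · simp [det_transvection_of_ne, hAB]
  · simp [det_transvection_of_ne, hAB.symm]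

/-- `R̂` satisfies Lando's 4-term relation:
`R̂(G) − R̂(G'_{AB}) − R̂(G̃_{AB}) + R̂(G̃'_{AB}) = 0`. -/
theorem Rhat_four_term {V : Type*} [Fintype V] [DecidableEq V]
    (G : SimpleGraph V) (A B : V) (hAB : A ≠ B) :
    Rhat G - Rhat (toggleEdge G A B) - Rhat (gTilde G A B)
      + Rhat (toggleEdge (gTilde G A B) A B) = 0 := by
  rw [toggleEdge_gTilde G hAB]
  simp only [Rhat, ← Finset.sum_sub_distrib, ← Finset.sum_add_distrib]
  refine Finset.sum_eq_zero fun J _ => ?_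
  by_cases hJ : A ∈ J ∧ B ∈ J
  · rw [rank_inducedAdj_gTilde G hAB hJ.1 hJ.2, rank_inducedAdj_gTilde _ hAB hJ.1 hJ.2]
    ring
  · rw [← toggleEdge_gTilde G hAB, inducedAdj_toggleEdge G hAB hJ, inducedAdj_toggleEdge _ hAB hJ]
    ring
end

section
/- Let k ≥ 1, let σ be a fixed-point-free involution of ZMod (2k) (a chord diagram of degree k), and let m ⊆ ZMod (2k) be σ-invariant (i ∈ m iff σ(i) ∈ m), so that m determines a set of marked chords. Let M_m be the k × k matrix over ℤ/2ℤ indexed by the chords of σ, whose off-diagonal entries are 1 exactly for pairs of interlacing chords and whose diagonal entry at a chord is 1 exactly when that chord is marked. Define the map T_{σ,m} on ZMod (2k) × Bool by: T(i, true) = (σ(i+1), true) if i+1 ∉ m and T(i, true) = (σ(i+1) − 1, false) if i+1 ∈ m; T(i, false) = (σ(i) − 1, false) if i ∉ m and T(i, false) = (σ(i), true) if i ∈ m. Then T_{σ,m} is a bijection of ZMod (2k) × Bool, and the number of its orbits equals 2·(k + 1 − rank(M_m)), where rank is taken over ℤ/2ℤ. (This is the combinatorial content of the Kauffman weight system identity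 K(D) = (ab)^k S(Γ(D))(b^{−1}): replacing each unmarked chord by an untwisted band and each marked chord by a half-twisted band yields a surface whose number of boundary components c satisfies rank(M_m) = k − c + 1, and the boundary components correspond to the orbit-pairs of T_{σ,m}.) -/
open Matrix

/-- The type of chords of the chord diagram given by a fixed-point-free
involution `σ` of `ZMod (2k)`: each chord is represented by its endpoint with
the smaller representative in `{0, 1, …, 2k−1}`. -/
abbrev Chord (k : ℕ) (σ : Equiv.Perm (ZMod (2 * k))) : Type :=
  {i : ZMod (2 * k) // i.val < (σ i).val}

/-- Two chords `{a, σ a}` and `{c, σ c}` (with `a.val < (σ a).val` and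
`c.val < (σ c).val`) interlace iff exactly one of `c`, `σ c` lies strictly
between `a` and `σ a`. -/
def Interlace (k : ℕ) (σ : Equiv.Perm (ZMod (2 * k))) (a c : ZMod (2 * k)) : Prop :=
  Xor' (a.val < c.val ∧ c.val < (σ a).val) (a.val < (σ c).val ∧ (σ c).val < (σ a).val)

open Classical in
/-- The marked adjacency matrix `M_m` over `ℤ/2ℤ` of the marked chord diagram
`(σ, m)`: off-diagonal entries are `1` exactly for pairs of interlacing chords,
and the diagonal entry at a chord is `1` exactly when that chord is marked
(i.e. its endpoints lie in `m`). -/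
noncomputable def markedInterMat (k : ℕ) (σ : Equiv.Perm (ZMod (2 * k)))
    (m : Finset (ZMod (2 * k))) :
    Matrix (Chord k σ) (Chord k σ) (ZMod 2) :=
  Matrix.of fun a c =>
    if a = c then (if a.1 ∈ m then 1 else 0)
    else (if Interlace k σ a.1 c.1 then 1 else 0)

/-- The boundary-tracing map `T_{σ,m}` on `ZMod (2k) × Bool`:
`T(i, true) = (σ(i+1), true)` if `i+1 ∉ m` and `T(i, true) = (σ(i+1) − 1, false)`
if `i+1 ∈ m`; `T(i, false) = (σ(i) − 1, false)` if `i ∉ m` and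
`T(i, false) = (σ(i), true)` if `i ∈ m`. -/
def Tmap (k : ℕ) (σ : Equiv.Perm (ZMod (2 * k))) (m : Finset (ZMod (2 * k))) :
    ZMod (2 * k) × Bool → ZMod (2 * k) × Bool
  | (i, true) => if i + 1 ∈ m then (σ (i + 1) - 1, false) else (σ (i + 1), true)
  | (i, false) => if i ∈ m then (σ i, true) else (σ i - 1, false)

/-- The number of orbits of a map `f : α → α`: the number of equivalence
classes of the equivalence relation generated by `x ∼ f x`. -/
noncomputable def orbitCount {α : Type*} (f : α → α) : ℕ :=
  Nat.card (Quotient (Relation.EqvGen.setoid (fun x y => f x = y)))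

section BoundaryTracing

variable {k : ℕ} {σ : Equiv.Perm (ZMod (2 * k))} {m : Finset (ZMod (2 * k))}

/-- Reversal of the direction of travel. -/
def reverseState (k : ℕ) (s : ZMod (2 * k) × Bool) : ZMod (2 * k) × Bool := (s.1, !s.2)

@[simp]
lemma reverseState_reverseState (s : ZMod (2 * k) × Bool) :
    reverseState k (reverseState k s) = s := by
  simp [reverseState]

lemma Tmap_reverseState_Tmap (hinv : ∀ i, σ (σ i) = i) (hm : ∀ i, i ∈ m ↔ σ i ∈ m)
    (s : ZMod (2 * k) × Bool) :
    Tmap k σ m (reverseState k (Tmap k σ m s)) = reverseState k s := by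
  obtain ⟨i, _ | _⟩ := s
  · by_cases h : i ∈ m
    · have h' := (hm i).1 h
      simp [Tmap, reverseState, h, h', hinv]
    · have h' := mt (hm i).2 h
      simp [Tmap, reverseState, h, h', hinv]
  · by_cases h : i + 1 ∈ m
    · have h' := (hm _).1 h
      simp [Tmap, reverseState, h, h', hinv]
    · have h' := mt (hm _).2 h
      simp [Tmap, reverseState, h, h', hinv]

lemma Tmap_injective (hinv : ∀ i, σ (σ i) = i) (hm : ∀ i, i ∈ m ↔ σ i ∈ m) :
    Function.Injective (Tmap k σ m) := by
  intro s t h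
  have := Tmap_reverseState_Tmap hinv hm s
  rw [h, Tmap_reverseState_Tmap hinv hm t] at this
  simpa using congrArg (reverseState k) this.symm

lemma Tmap_bijective [NeZero (2 * k)] (hinv : ∀ i, σ (σ i) = i) (hm : ∀ i, i ∈ m ↔ σ i ∈ m) :
    Function.Bijective (Tmap k σ m) :=
  Finite.injective_iff_bijective.1 (Tmap_injective hinv hm)

lemma Tmap_ne_reverseState (hfix : ∀ i, σ i ≠ i) (s : ZMod (2 * k) × Bool) :
    Tmap k σ m s ≠ reverseState k s := by
  obtain ⟨i, _ | _⟩ := s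
  · by_cases h : i ∈ m <;> simp [Tmap, reverseState, h, hfix]
  · by_cases h : i + 1 ∈ m <;> simp [Tmap, reverseState, h, sub_eq_iff_eq_add, hfix]

lemma iterate_Tmap_ne_reverseState (hinv : ∀ i, σ (σ i) = i) (hfix : ∀ i, σ i ≠ i)
    (hm : ∀ i, i ∈ m ↔ σ i ∈ m) (n : ℕ) (s : ZMod (2 * k) × Bool) :
    (Tmap k σ m)^[n] s ≠ reverseState k s := by
  induction n using Nat.strong_induction_on generalizing s with
  | _ n ih =>
    match n with
    | 0 => simp [reverseState, Prod.ext_iff]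
    | 1 => exact Tmap_ne_reverseState hfix s
    | n + 2 =>
      intro h
      refine ih n (by omega) (Tmap k σ m s) (Tmap_injective hinv hm ?_)
      rw [Tmap_reverseState_Tmap hinv hm, ← h, ← Function.iterate_succ_apply' (Tmap k σ m),
        ← Function.iterate_succ_apply (Tmap k σ m)]

/-- The orbit relation of the boundary-tracing map. -/
abbrev stateSetoid (k : ℕ) (σ : Equiv.Perm (ZMod (2 * k))) (m : Finset (ZMod (2 * k))) :
    Setoid (ZMod (2 * k) × Bool) :=
  Relation.EqvGen.setoid (fun x y => Tmap k σ m x = y)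

lemma stateSetoid_reverseState (hinv : ∀ i, σ (σ i) = i) (hm : ∀ i, i ∈ m ↔ σ i ∈ m)
    {s t : ZMod (2 * k) × Bool} (h : stateSetoid k σ m s t) :
    stateSetoid k σ m (reverseState k s) (reverseState k t) := by
  induction h with
  | rel s t h =>
    subst h
    exact .symm _ _ (.rel _ _ (Tmap_reverseState_Tmap hinv hm s))
  | refl s => exact .refl _
  | symm s t _ ih => exact .symm _ _ ih
  | trans s t u _ _ ih₁ ih₂ => exact .trans _ _ _ ih₁ ih₂

lemma not_stateSetoid_reverseState [NeZero (2 * k)] (hinv : ∀ i, σ (σ i) = i)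
    (hfix : ∀ i, σ i ≠ i) (hm : ∀ i, i ∈ m ↔ σ i ∈ m) (s : ZMod (2 * k) × Bool) :
    ¬ stateSetoid k σ m s (reverseState k s) := by
  let e : Equiv.Perm (ZMod (2 * k) × Bool) := Equiv.ofBijective _ (Tmap_bijective hinv hm)
  have key : ∀ {s t}, stateSetoid k σ m s t → e.SameCycle s t := by
    intro s t h
    induction h with
    | rel s t h => exact ⟨1, by simpa [e] using h⟩
    | refl s => exact .refl _ _
    | symm s t _ ih => exact ih.symm
    | trans s t u _ _ ih₁ ih₂ => exact ih₁.trans ih₂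
  intro h
  obtain ⟨n, -, hn⟩ := (key h).exists_pow_eq'
  refine iterate_Tmap_ne_reverseState hinv hfix hm n s ?_
  rw [← hn, ← Equiv.Perm.iterate_eq_pow]
  rfl

/-- The relation of lying on the same boundary component, on the arcs of the circle. -/
def arcSetoid (hinv : ∀ i, σ (σ i) = i) (hm : ∀ i, i ∈ m ↔ σ i ∈ m) :
    Setoid (ZMod (2 * k)) where
  r i j := ∃ b, stateSetoid k σ m (i, true) (j, b)
  iseqv := by
    refine ⟨fun i => ⟨true, .refl _⟩, ?_, ?_⟩
    · rintro i j ⟨_ | _, h⟩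
      · exact ⟨false, .symm _ _ (stateSetoid_reverseState hinv hm h)⟩
      · exact ⟨true, .symm _ _ h⟩
    · rintro i j l ⟨_ | _, h⟩ ⟨b, h'⟩
      · exact ⟨!b, .trans _ _ _ h (stateSetoid_reverseState hinv hm h')⟩
      · exact ⟨b, .trans _ _ _ h h'⟩

lemma arcSetoid_of_stateSetoid (hinv : ∀ i, σ (σ i) = i) (hm : ∀ i, i ∈ m ↔ σ i ∈ m)
    {s t : ZMod (2 * k) × Bool} (h : stateSetoid k σ m s t) : arcSetoid hinv hm s.1 t.1 := by
  obtain ⟨i, _ | _⟩ := s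
  · exact ⟨_, stateSetoid_reverseState hinv hm h⟩
  · exact ⟨_, h⟩

lemma orbitCount_Tmap [NeZero (2 * k)] (hinv : ∀ i, σ (σ i) = i)
    (hfix : ∀ i, σ i ≠ i) (hm : ∀ i, i ∈ m ↔ σ i ∈ m) :
    orbitCount (Tmap k σ m) = 2 * Nat.card (Quotient (arcSetoid hinv hm)) := by
  let φ : Quotient (arcSetoid hinv hm) × Bool → Quotient (stateSetoid k σ m) :=
    fun p => Quotient.mk _ (p.1.out, p.2)
  have hφ : Function.Bijective φ := by
    constructor
    · rintro ⟨p, b⟩ ⟨q, c⟩ h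
      have h : stateSetoid k σ m (p.out, b) (q.out, c) := Quotient.exact h
      obtain rfl : p = q := by
        rw [← p.out_eq, ← q.out_eq]
        exact Quotient.sound (arcSetoid_of_stateSetoid hinv hm h)
      by_cases hbc : b = c
      · rw [hbc]
      · obtain rfl : c = !b := by cases b <;> cases c <;> simp_all
        exact (not_stateSetoid_reverseState hinv hfix hm _ h).elim
    · intro q
      induction q using Quotient.inductionOn with
      | _ s =>
        obtain ⟨i, b⟩ := s
        obtain ⟨c, h⟩ : arcSetoid hinv hm i (Quotient.mk (arcSetoid hinv hm) i).out :=
          (arcSetoid hinv hm).symm' (Quotient.mk_out i)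
        cases b
        · exact ⟨(Quotient.mk _ i, !c),
            Quotient.sound ((stateSetoid k σ m).symm' (stateSetoid_reverseState hinv hm h))⟩
        · exact ⟨(Quotient.mk _ i, c), Quotient.sound ((stateSetoid k σ m).symm' h)⟩
  unfold orbitCount
  rw [← Nat.card_congr (Equiv.ofBijective φ hφ), Nat.card_prod]
  simp [mul_comm]

/-- Labellings of the arcs that are constant along boundary components. -/
def BoundaryLabelling (k : ℕ) (σ : Equiv.Perm (ZMod (2 * k))) (m : Finset (ZMod (2 * k))) :
    Type :=
  {f : ZMod (2 * k) → ZMod 2 // ∀ s, f (Tmap k σ m s).1 = f s.1}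

/-- Labellings constant along boundary components are functions on boundary components. -/
def boundaryLabellingEquiv (hinv : ∀ i, σ (σ i) = i) (hm : ∀ i, i ∈ m ↔ σ i ∈ m) :
    (Quotient (arcSetoid hinv hm) → ZMod 2) ≃ BoundaryLabelling k σ m where
  toFun g := ⟨fun i => g (Quotient.mk _ i), fun s => congrArg g <| Quotient.sound <|
    (arcSetoid hinv hm).symm' <| arcSetoid_of_stateSetoid hinv hm (.rel _ _ rfl)⟩
  invFun f := Quotient.lift f.1 <| by
    rintro i j ⟨b, h⟩
    have key : ∀ {s t}, stateSetoid k σ m s t → f.1 s.1 = f.1 t.1 := by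
      intro s t h
      induction h with
      | rel s t h => rw [← h, f.2]
      | refl s => rfl
      | symm s t _ ih => exact ih.symm
      | trans s t u _ _ ih₁ ih₂ => exact ih₁.trans ih₂
    exact key h
  left_inv g := by
    funext q
    induction q using Quotient.inductionOn
    rfl
  right_inv f := rfl

lemma isBoundaryLabelling_iff [NeZero (2 * k)] (hinv : ∀ i, σ (σ i) = i)
    (hfix : ∀ i, σ i ≠ i) (hm : ∀ i, i ∈ m ↔ σ i ∈ m)
    (f : ZMod (2 * k) → ZMod 2) :
    (∀ s, f (Tmap k σ m s).1 = f s.1) ↔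
      (∀ i, f (σ i) - f (σ i - 1) = f i - f (i - 1)) ∧
        ∀ i : Chord k σ, f (σ i) = f i + if i.1 ∈ m then 0 else f i - f (i - 1) := by
  have two : ∀ a b : ZMod 2, a + (a - b) = b := by decide
  constructor
  · intro h
    have h₁ : ∀ i, f (σ i) = f i + if i ∈ m then 0 else f i - f (i - 1) := by
      intro i
      by_cases hi : i ∈ m
      · simpa [Tmap, hi] using h (i, false)
      · simpa [Tmap, hi, two] using h (i - 1, true)
    have h₂ : ∀ i, f (σ i - 1) = if i ∈ m then f (i - 1) else f i := by
      intro i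
      by_cases hi : i ∈ m
      · simpa [Tmap, hi] using h (i - 1, true)
      · simpa [Tmap, hi] using h (i, false)
    refine ⟨fun i => ?_, fun i => h₁ i⟩
    rw [h₁, h₂]
    generalize f i = a, f (i - 1) = b
    split_ifs <;> revert a b <;> decide
  · rintro ⟨hd, hc⟩
    have h₁ : ∀ i, f (σ i) = f i + if i ∈ m then 0 else f i - f (i - 1) := by
      intro i
      rcases lt_trichotomy i.val (σ i).val with hi | hi | hi
      · exact hc ⟨i, hi⟩
      · exact (hfix i (ZMod.val_injective _ hi.symm)).elim
      · have := hc ⟨σ i, by simpa [hinv] using hi⟩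
        simp only [hinv, ← hm, hd] at this
        revert this
        generalize f i = a, f (i - 1) = b, f (σ i) = c
        split_ifs <;> revert a b c <;> decide
    have h₂ : ∀ i, f (σ i - 1) = if i ∈ m then f (i - 1) else f i := by
      intro i
      have e₁ := h₁ i
      have e₂ := hd i
      revert e₁ e₂
      generalize f i = a, f (i - 1) = b, f (σ i) = c, f (σ i - 1) = d
      split_ifs <;> revert a b c d <;> decide
    rintro ⟨i, _ | _⟩
    · by_cases hi : i ∈ m
      · simpa [Tmap, hi] using h₁ i
      · simpa [Tmap, hi] using h₂ i
    · by_cases hi : i + 1 ∈ m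
      · simpa [Tmap, hi] using h₂ (i + 1)
      · simpa [Tmap, hi, two] using h₁ (i + 1)

/-- A sum over endpoints is a sum over chords. -/
lemma sum_endpoints_eq_sum_chords [NeZero (2 * k)] {M : Type*} [AddCommMonoid M]
    (hinv : ∀ i, σ (σ i) = i) (hfix : ∀ i, σ i ≠ i) (g : ZMod (2 * k) → M) :
    ∑ i, g i = ∑ c : Chord k σ, (g c + g (σ c)) := by
  rw [← Finset.sum_filter_add_sum_filter_not Finset.univ (fun i => i.val < (σ i).val),
    Finset.sum_add_distrib]
  congr 1
  · exact Finset.sum_subtype _ (by simp) g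
  · rw [← Finset.sum_subtype (Finset.univ.filter fun i => i.val < (σ i).val) (by simp)
      (fun i => g (σ i))]
    refine Finset.sum_nbij' σ σ ?_ ?_ ?_ ?_ ?_
    · intro i hi
      have h : (σ i).val ≠ i.val := fun h => hfix i (ZMod.val_injective _ h)
      simp only [Finset.mem_filter, Finset.mem_univ, true_and, hinv] at hi ⊢
      omega
    · intro i hi
      simp only [Finset.mem_filter, Finset.mem_univ, true_and, hinv] at hi ⊢
      omega
    all_goals simp [hinv]

lemma card_chord [NeZero (2 * k)] (hinv : ∀ i, σ (σ i) = i) (hfix : ∀ i, σ i ≠ i) :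
    Fintype.card (Chord k σ) = k := by
  have := sum_endpoints_eq_sum_chords hinv hfix (fun _ => (1 : ℕ))
  simp at this
  omega

open Classical in
lemma markedInterMat_mulVec [NeZero (2 * k)] (hinv : ∀ i, σ (σ i) = i) (hfix : ∀ i, σ i ≠ i)
    (y : ZMod (2 * k) → ZMod 2) (hy : ∀ i, y (σ i) = y i) (a : Chord k σ) :
    (markedInterMat k σ m *ᵥ fun c => y c) a =
      (∑ j, if a.1.val < j.val ∧ j.val < (σ a).val then y j else 0) +
        if a.1 ∈ m then y a else 0 := by
  have hdiag : (if a.1 ∈ m then y a else 0) =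
      ∑ c : Chord k σ, if c = a then (if c.1 ∈ m then y c else 0) else 0 := by simp
  rw [sum_endpoints_eq_sum_chords hinv hfix, hdiag, ← Finset.sum_add_distrib]
  change ∑ c : Chord k σ, markedInterMat k σ m a c * y c = _
  refine Finset.sum_congr rfl fun c _ => ?_
  have two : ∀ z : ZMod 2, z + z = 0 := by decide
  by_cases h : c = a
  · subst h
    simp [markedInterMat]
  · simp only [markedInterMat, Matrix.of_apply, Ne.symm h, h, if_false, Interlace, hy, add_zero]
    by_cases h₁ : a.1.val < c.1.val ∧ c.1.val < (σ a).val <;>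
    by_cases h₂ : a.1.val < (σ c).val ∧ (σ c).val < (σ a).val <;>
    simp [h₁, h₂, Xor', two]

/-- Telescoping along the circle. -/
lemma sum_between_sub {N : ℕ} [NeZero N] {G : Type*} [AddCommGroup G] (f : ZMod N → G)
    (a b : ZMod N) (hab : a.val < b.val) :
    (∑ j, if a.val < j.val ∧ j.val < b.val then f j - f (j - 1) else 0) =
      f (b - 1) - f a := by
  have hb := b.val_lt
  have h₁ : (∑ j, if a.val < j.val ∧ j.val < b.val then f j - f (j - 1) else 0) =
      ∑ n ∈ Finset.Ico a.val (b.val - 1), (f (n + 1 : ℕ) - f (n : ℕ)) := by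
    rw [← Finset.sum_filter]
    refine Finset.sum_nbij' (fun j => j.val - 1) (fun n => ((n + 1 : ℕ) : ZMod N)) ?_ ?_ ?_ ?_ ?_
    · intro j hj
      simp only [Finset.mem_filter, Finset.mem_univ, true_and, Finset.mem_Ico] at hj ⊢
      omega
    · intro n hn
      simp only [Finset.mem_filter, Finset.mem_univ, true_and, Finset.mem_Ico] at hn ⊢
      rw [ZMod.val_natCast_of_lt (by omega)]
      omega
    · intro j hj
      simp only [Finset.mem_filter, Finset.mem_univ, true_and] at hj
      rw [Nat.sub_add_cancel (by omega), ZMod.natCast_zmod_val]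
    · intro n hn
      simp only [Finset.mem_Ico] at hn
      rw [ZMod.val_natCast_of_lt (by omega), Nat.add_sub_cancel]
    · intro j hj
      simp only [Finset.mem_filter, Finset.mem_univ, true_and] at hj
      rw [Nat.sub_add_cancel (by omega), Nat.cast_sub (by omega), ZMod.natCast_zmod_val,
        Nat.cast_one]
  rw [h₁, Finset.sum_Ico_sub (fun n : ℕ => f n) (by omega), Nat.cast_sub (by omega)]
  simp

lemma markedInterMat_mulVec_sub [NeZero (2 * k)] (hinv : ∀ i, σ (σ i) = i) (hfix : ∀ i, σ i ≠ i)
    (f : ZMod (2 * k) → ZMod 2) (hf : ∀ i, f (σ i) - f (σ i - 1) = f i - f (i - 1))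
    (a : Chord k σ) :
    (markedInterMat k σ m *ᵥ fun c => f c - f (c - 1)) a = 0 ↔
      f (σ a) = f a + if a.1 ∈ m then 0 else f a - f (a - 1) := by
  rw [markedInterMat_mulVec hinv hfix (fun i => f i - f (i - 1)) hf, sum_between_sub f _ _ a.2]
  have := hf a
  revert this
  generalize f a = a₀, f (a - 1) = a₁, f (σ a) = b₀, f (σ a - 1) = b₁
  split_ifs <;> revert a₀ a₁ b₀ b₁ <;> decide

/-- A function on the circle is determined by its differences and its value at zero. -/
lemma eq_of_sub_eq {N : ℕ} [NeZero N] {G : Type*} [AddCommGroup G] {f g : ZMod N → G}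
    (h₀ : f 0 = g 0) (h : ∀ i, f i - f (i - 1) = g i - g (i - 1)) : f = g := by
  have key : ∀ n : ℕ, f n = g n := by
    intro n
    induction n with
    | zero => simpa using h₀
    | succ n ih =>
      have := h (n + 1 : ℕ)
      simpa [ih] using this
  funext i
  simpa using key i.val

/-- A function on the circle with zero sum is a difference. -/
lemma exists_sub_eq {N : ℕ} [NeZero N] {G : Type*} [AddCommGroup G] (y : ZMod N → G)
    (hy : ∑ i, y i = 0) (e : G) :
    ∃ f : ZMod N → G, f 0 = e ∧ ∀ i, f i - f (i - 1) = y i := by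
  have hN : N - 1 + 1 = N := Nat.sub_add_cancel (NeZero.pos N)
  have hsum : ∑ n ∈ Finset.range N, y n = 0 := by
    rw [← hy]
    refine Finset.sum_nbij' (fun n => (n : ZMod N)) ZMod.val ?_ ?_ ?_ ?_ ?_
    · simp
    · simp [ZMod.val_lt]
    · intro n hn
      exact ZMod.val_natCast_of_lt (by simpa using hn)
    · simp
    · simp
  have hneg : (-1 : ZMod N).val = N - 1 := by
    have : (-1 : ZMod N) = ((N - 1 : ℕ) : ZMod N) := by
      rw [Nat.cast_sub (NeZero.pos N)]
      simp
    rw [this, ZMod.val_natCast_of_lt (by omega)]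
  refine ⟨fun i => e + ∑ n ∈ Finset.range i.val, y (n + 1 : ℕ), by simp, fun i => ?_⟩
  by_cases hi : i = 0
  · subst hi
    rw [show Finset.range N = Finset.range (N - 1 + 1) by rw [hN],
      Finset.sum_range_succ'] at hsum
    simp only [ZMod.val_zero, zero_sub, hneg, Finset.range_zero, Finset.sum_empty]
    rw [eq_neg_of_add_eq_zero_left hsum]
    simp
  · have hpos : 0 < i.val := Nat.pos_of_ne_zero (by simpa using hi)
    have hlt := i.val_lt
    have hsub : (i - 1).val = i.val - 1 := by
      have : i - 1 = ((i.val - 1 : ℕ) : ZMod N) := by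
        rw [Nat.cast_sub hpos]
        simp
      rw [this, ZMod.val_natCast_of_lt (by omega)]
    obtain ⟨n, hn⟩ : ∃ n, i.val = n + 1 := ⟨i.val - 1, by omega⟩
    have hi' : ((n + 1 : ℕ) : ZMod N) = i := by rw [← hn, ZMod.natCast_zmod_val]
    simp only [hsub, hn, Nat.add_sub_cancel, Finset.sum_range_succ, hi']
    abel

/-- A labelling of the chords is a `σ`-invariant labelling of the endpoints. -/
lemma exists_invariant_extension [NeZero (2 * k)] (hinv : ∀ i, σ (σ i) = i)
    (hfix : ∀ i, σ i ≠ i) {α : Type*} (x : Chord k σ → α) :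
    ∃ y : ZMod (2 * k) → α, (∀ i, y (σ i) = y i) ∧ ∀ c : Chord k σ, y c = x c := by
  have hlt : ∀ i, ¬ i.val < (σ i).val → (σ i).val < (σ (σ i)).val := by
    intro i hi
    have h : (σ i).val ≠ i.val := fun h => hfix i (ZMod.val_injective _ h)
    rw [hinv]
    omega
  refine ⟨fun i => if h : i.val < (σ i).val then x ⟨i, h⟩ else x ⟨σ i, hlt i h⟩, ?_, ?_⟩
  · intro i
    by_cases h : i.val < (σ i).val
    · simp [hinv, h, h.not_gt]
    · have h' := hlt i h
      rw [hinv] at h'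
      simp [hinv, h, h']
  · intro c
    simp [c.2]

lemma card_boundaryLabelling [NeZero (2 * k)] (hinv : ∀ i, σ (σ i) = i) (hfix : ∀ i, σ i ≠ i)
    (hm : ∀ i, i ∈ m ↔ σ i ∈ m) :
    Nat.card (BoundaryLabelling k σ m) =
      2 * Nat.card (LinearMap.ker (markedInterMat k σ m).mulVecLin) := by
  let φ : BoundaryLabelling k σ m → ZMod 2 × LinearMap.ker (markedInterMat k σ m).mulVecLin :=
    fun f => (f.1 0, ⟨fun c => f.1 c - f.1 (c - 1), by
      obtain ⟨h₁, h₂⟩ := (isBoundaryLabelling_iff hinv hfix hm f.1).1 f.2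
      rw [LinearMap.mem_ker, Matrix.mulVecLin_apply]
      funext a
      exact (markedInterMat_mulVec_sub hinv hfix f.1 h₁ a).2 (h₂ a)⟩)
  have hφ : Function.Bijective φ := by
    constructor
    · intro f g h
      have hf := ((isBoundaryLabelling_iff hinv hfix hm f.1).1 f.2).1
      have hg := ((isBoundaryLabelling_iff hinv hfix hm g.1).1 g.2).1
      have h₀ : f.1 0 = g.1 0 := congrArg Prod.fst h
      have hc : ∀ c : Chord k σ, f.1 c - f.1 (c - 1) = g.1 c - g.1 (c - 1) :=
        fun c => congrFun (congrArg Subtype.val (congrArg Prod.snd h)) c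
      refine Subtype.ext (eq_of_sub_eq h₀ fun i => ?_)
      rcases lt_trichotomy i.val (σ i).val with hi | hi | hi
      · exact hc ⟨i, hi⟩
      · exact (hfix i (ZMod.val_injective _ hi.symm)).elim
      · rw [← hf, ← hg]
        exact hc ⟨σ i, by simpa [hinv] using hi⟩
    · rintro ⟨e, x, hx⟩
      obtain ⟨y, hy, hyx⟩ := exists_invariant_extension hinv hfix x
      have hsum : ∑ i, y i = 0 := by
        rw [sum_endpoints_eq_sum_chords hinv hfix]
        exact Finset.sum_eq_zero fun c _ => by rw [hy, CharTwo.add_self_eq_zero]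
      obtain ⟨f, hf₀, hf⟩ := exists_sub_eq y hsum e
      have hd : ∀ i, f (σ i) - f (σ i - 1) = f i - f (i - 1) := fun i => by rw [hf, hf, hy]
      have hxf : (fun c : Chord k σ => f c - f (c - 1)) = x := by
        funext c
        rw [hf, hyx]
      refine ⟨⟨f, (isBoundaryLabelling_iff hinv hfix hm f).2 ⟨hd, fun a => ?_⟩⟩, ?_⟩
      · rw [← markedInterMat_mulVec_sub hinv hfix f hd, hxf]
        exact congrFun (LinearMap.mem_ker.1 hx) a
      · exact Prod.ext hf₀ (Subtype.ext hxf)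
  rw [Nat.card_congr (Equiv.ofBijective φ hφ), Nat.card_prod, Nat.card_zmod]

lemma card_arcSetoid_add_rank [NeZero (2 * k)] (hinv : ∀ i, σ (σ i) = i) (hfix : ∀ i, σ i ≠ i)
    (hm : ∀ i, i ∈ m ↔ σ i ∈ m) :
    Nat.card (Quotient (arcSetoid hinv hm)) + (markedInterMat k σ m).rank = k + 1 := by
  have h := card_boundaryLabelling hinv hfix hm
  rw [← Nat.card_congr (boundaryLabellingEquiv hinv hm), Nat.card_fun, Nat.card_zmod,
    Module.natCard_eq_pow_finrank (K := ZMod 2)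
      (V := LinearMap.ker (markedInterMat k σ m).mulVecLin), Nat.card_zmod, ← pow_succ'] at h
  have h' := Nat.pow_right_injective le_rfl h
  have hr := LinearMap.finrank_range_add_finrank_ker (markedInterMat k σ m).mulVecLin
  rw [Module.finrank_fintype_fun_eq_card, card_chord hinv hfix] at hr
  unfold Matrix.rank
  omega

end BoundaryTracing

/-- For a marked chord diagram `(σ, m)` of degree `k ≥ 1` (with `m` a
`σ`-invariant set of endpoints), the map `T_{σ,m}` is a bijection of
`ZMod (2k) × Bool`, and the number of its orbits equals
`2 · (k + 1 − rank(M_m))`, where the rank of the marked adjacency matrix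
is taken over `ℤ/2ℤ`. -/
theorem Tmap_bijective_and_orbitCount (k : ℕ) (hk : 1 ≤ k) [NeZero (2 * k)]
    (σ : Equiv.Perm (ZMod (2 * k)))
    (hinv : ∀ i, σ (σ i) = i) (hfix : ∀ i, σ i ≠ i)
    (m : Finset (ZMod (2 * k))) (hm : ∀ i, i ∈ m ↔ σ i ∈ m) :
    Function.Bijective (Tmap k σ m) ∧
    orbitCount (Tmap k σ m) = 2 * (k + 1 - (markedInterMat k σ m).rank) := by
  refine ⟨Tmap_bijective hinv hm, ?_⟩
  rw [orbitCount_Tmap hinv hfix hm, ← card_arcSetoid_add_rank hinv hfix hm, Nat.add_sub_cancel]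
end
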